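/- arXiv:2506.03042 — 2 statements merged into one kernel-verified Lean document; each statement's English description precedes it below -/
import Mathlib

section
/- Let n ≥ 1, let H be an n×n real matrix, and let θ, ρ ∈ ℝ. Let D = D(θ,ρ) be the 2×2 matrix with first row (cos θ + ρ sin θ, −sin θ·√(1+ρ²)) and second row (sin θ − ρ cos θ, cos θ·√(1+ρ²)). Then (D ⊗ I_n)⁻¹ · (I₂ ⊗ H) · ((D ⊗ I_n)⁻¹)ᵀ = (Dᵀ·D)⁻¹ ⊗ H, and this matrix does not depend on θ. -/
open Real Matrix
open scoped Kronecker

/-- The dependence matrix of the bivariate Matérn–SPDE system. -/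
noncomputable def depMatrix (θ ρ : ℝ) : Matrix (Fin 2) (Fin 2) ℝ :=
  !![Real.cos θ + ρ * Real.sin θ, -Real.sin θ * Real.sqrt (1 + ρ ^ 2);
     Real.sin θ - ρ * Real.cos θ, Real.cos θ * Real.sqrt (1 + ρ ^ 2)]

/-- `DᵀD` for the dependence matrix `D = D(θ,ρ)`, written without `θ`. -/
theorem depMatrix_transpose_mul_self (θ ρ : ℝ) :
    (depMatrix θ ρ)ᵀ * depMatrix θ ρ =
      !![1 + ρ ^ 2, -ρ * Real.sqrt (1 + ρ ^ 2); -ρ * Real.sqrt (1 + ρ ^ 2), 1 + ρ ^ 2] := by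
  have hs : Real.sqrt (1 + ρ ^ 2) ^ 2 = 1 + ρ ^ 2 := Real.sq_sqrt (by positivity)
  have hc := Real.sin_sq_add_cos_sq θ
  ext i j
  fin_cases i <;> fin_cases j <;>
    simp [depMatrix, Matrix.mul_apply, Fin.sum_univ_two]
  · linear_combination (1 + ρ ^ 2) * hc
  · linear_combination (-ρ * Real.sqrt (1 + ρ ^ 2)) * hc
  · linear_combination (-ρ * Real.sqrt (1 + ρ ^ 2)) * hc
  · linear_combination Real.sqrt (1 + ρ ^ 2) ^ 2 * hc + hs

/-- Conjugating `1 ⊗ H` by `(D ⊗ 1)⁻¹` gives `(DᵀD)⁻¹ ⊗ H`. -/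
theorem kronecker_one_inv_mul_mul_transpose {m n R : Type*} [Fintype m] [DecidableEq m]
    [Fintype n] [DecidableEq n] [CommRing R] (D : Matrix m m R) (H : Matrix n n R) :
    (D ⊗ₖ (1 : Matrix n n R))⁻¹ * ((1 : Matrix m m R) ⊗ₖ H) * ((D ⊗ₖ (1 : Matrix n n R))⁻¹)ᵀ =
      (Dᵀ * D)⁻¹ ⊗ₖ H := by
  rw [Matrix.inv_kronecker, ← Matrix.kroneckerMap_transpose, ← Matrix.mul_kronecker_mul,
    ← Matrix.mul_kronecker_mul, Matrix.mul_inv_rev, Matrix.transpose_nonsing_inv]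
  simp

/-- For `n ≥ 1`, an `n×n` matrix `H` and `θ, ρ ∈ ℝ`, with `D = D(θ,ρ)`:
`(D ⊗ Iₙ)⁻¹ (I₂ ⊗ H) ((D ⊗ Iₙ)⁻¹)ᵀ = (DᵀD)⁻¹ ⊗ H`, and this does not depend on `θ`. -/
theorem kronecker_sandwich_indep_theta (n : ℕ) (hn : 1 ≤ n)
    (H : Matrix (Fin n) (Fin n) ℝ) (θ ρ : ℝ) :
    ((depMatrix θ ρ ⊗ₖ (1 : Matrix (Fin n) (Fin n) ℝ))⁻¹ *
        ((1 : Matrix (Fin 2) (Fin 2) ℝ) ⊗ₖ H) *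
        ((depMatrix θ ρ ⊗ₖ (1 : Matrix (Fin n) (Fin n) ℝ))⁻¹)ᵀ =
      ((depMatrix θ ρ)ᵀ * depMatrix θ ρ)⁻¹ ⊗ₖ H) ∧
    ∀ θ' : ℝ,
      (depMatrix θ ρ ⊗ₖ (1 : Matrix (Fin n) (Fin n) ℝ))⁻¹ *
          ((1 : Matrix (Fin 2) (Fin 2) ℝ) ⊗ₖ H) *
          ((depMatrix θ ρ ⊗ₖ (1 : Matrix (Fin n) (Fin n) ℝ))⁻¹)ᵀ =
        (depMatrix θ' ρ ⊗ₖ (1 : Matrix (Fin n) (Fin n) ℝ))⁻¹ *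
          ((1 : Matrix (Fin 2) (Fin 2) ℝ) ⊗ₖ H) *
          ((depMatrix θ' ρ ⊗ₖ (1 : Matrix (Fin n) (Fin n) ℝ))⁻¹)ᵀ := by
  simp only [kronecker_one_inv_mul_mul_transpose, depMatrix_transpose_mul_self, implies_true,
    and_self]
end

section
/- Let σ > 0, μ, y ∈ ℝ, and let X, X′ be independent random variables with distribution N(μ, σ²). Set z = (y − μ)/σ. Then E|X − y| / E|X − X′| + ½·log(E|X − X′|) = (√π/2)·(z·(2Φ(z) − 1) + 2φ(z)) + ½·log(2σ/√π), where φ and Φ are the standard normal density and distribution function. -/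
open MeasureTheory Real ProbabilityTheory

/-- The standard normal probability density function `φ`. -/
noncomputable def stdNormalPDF (x : ℝ) : ℝ := Real.exp (-x ^ 2 / 2) / Real.sqrt (2 * π)

/-- The standard normal cumulative distribution function `Φ`. -/
noncomputable def stdNormalCDF (x : ℝ) : ℝ := ∫ t in Set.Iic x, stdNormalPDF t

open scoped NNReal

/-- The mean absolute deviation from `z` of a standard normal variable. -/
noncomputable def stdNormalMeanAbsDev (z : ℝ) : ℝ :=
  z * (2 * stdNormalCDF z - 1) + 2 * stdNormalPDF z

lemma stdNormalPDF_eq_gaussianPDFReal : stdNormalPDF = gaussianPDFReal 0 1 := by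
  ext x
  simp [stdNormalPDF, gaussianPDFReal, div_eq_inv_mul]

lemma integrable_stdNormalPDF : Integrable stdNormalPDF :=
  stdNormalPDF_eq_gaussianPDFReal ▸ integrable_gaussianPDFReal 0 1

lemma integral_stdNormalPDF : ∫ t, stdNormalPDF t = 1 :=
  stdNormalPDF_eq_gaussianPDFReal ▸ integral_gaussianPDFReal_eq_one 0 one_ne_zero

lemma integrable_mul_stdNormalPDF : Integrable fun t ↦ t * stdNormalPDF t := by
  refine ((integrable_mul_exp_neg_mul_sq (b := 1 / 2) (by norm_num)).div_const
    (√(2 * π))).congr (.of_forall fun t ↦ ?_)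
  simp only [stdNormalPDF]
  ring_nf

lemma hasDerivAt_stdNormalPDF (t : ℝ) :
    HasDerivAt stdNormalPDF (-(t * stdNormalPDF t)) t := by
  have h : HasDerivAt (fun x : ℝ ↦ -x ^ 2 / 2) (-t) t :=
    ((hasDerivAt_pow 2 t).neg.div_const 2).congr_deriv (by simp; ring)
  exact (h.exp.div_const (√(2 * π))).congr_deriv (by rw [stdNormalPDF]; ring)

lemma setIntegral_Iic_mul_stdNormalPDF (z : ℝ) :
    ∫ t in Set.Iic z, t * stdNormalPDF t = -stdNormalPDF z := by
  have hint : Integrable fun t ↦ -(t * stdNormalPDF t) := integrable_mul_stdNormalPDF.neg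
  have h := integral_Iic_of_hasDerivAt_of_tendsto' (a := z)
    (fun t _ ↦ hasDerivAt_stdNormalPDF t) hint.integrableOn
    (tendsto_zero_of_hasDerivAt_of_integrableOn_Iic (a := z)
      (fun t _ ↦ hasDerivAt_stdNormalPDF t) hint.integrableOn
      integrable_stdNormalPDF.integrableOn)
  rw [integral_neg, sub_zero] at h
  linarith

lemma setIntegral_Ioi_mul_stdNormalPDF (z : ℝ) :
    ∫ t in Set.Ioi z, t * stdNormalPDF t = stdNormalPDF z := by
  have hint : Integrable fun t ↦ -(t * stdNormalPDF t) := integrable_mul_stdNormalPDF.neg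
  have h := integral_Ioi_of_hasDerivAt_of_tendsto' (a := z)
    (fun t _ ↦ hasDerivAt_stdNormalPDF t) hint.integrableOn
    (tendsto_zero_of_hasDerivAt_of_integrableOn_Ioi (a := z)
      (fun t _ ↦ hasDerivAt_stdNormalPDF t) hint.integrableOn
      integrable_stdNormalPDF.integrableOn)
  rw [integral_neg, zero_sub] at h
  linarith

lemma setIntegral_Ioi_stdNormalPDF (z : ℝ) :
    ∫ t in Set.Ioi z, stdNormalPDF t = 1 - stdNormalCDF z := by
  have h := integral_add_compl (measurableSet_Iic (a := z)) integrable_stdNormalPDF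
  rw [Set.compl_Iic, integral_stdNormalPDF] at h
  rw [stdNormalCDF]
  linarith

lemma integral_stdNormalPDF_mul_abs_sub (z : ℝ) :
    ∫ t, stdNormalPDF t * |t - z| = stdNormalMeanAbsDev z := by
  have hint : Integrable fun t ↦ t * stdNormalPDF t - z * stdNormalPDF t :=
    integrable_mul_stdNormalPDF.sub (integrable_stdNormalPDF.const_mul z)
  have habs : Integrable fun t ↦ stdNormalPDF t * |t - z| :=
    hint.abs.congr (.of_forall fun t ↦ by
      have : 0 ≤ stdNormalPDF t := by rw [stdNormalPDF]; positivity
      simp only [← sub_mul, abs_mul, abs_of_nonneg this, mul_comm])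
  rw [← integral_add_compl (measurableSet_Iic (a := z)) habs, Set.compl_Iic]
  have h₁ : ∫ t in Set.Iic z, stdNormalPDF t * |t - z|
      = ∫ t in Set.Iic z, (z * stdNormalPDF t - t * stdNormalPDF t) :=
    setIntegral_congr_fun measurableSet_Iic fun t ht ↦ by
      simp only [abs_of_nonpos (sub_nonpos.2 (Set.mem_Iic.1 ht))]
      ring
  have h₂ : ∫ t in Set.Ioi z, stdNormalPDF t * |t - z|
      = ∫ t in Set.Ioi z, (t * stdNormalPDF t - z * stdNormalPDF t) :=
    setIntegral_congr_fun measurableSet_Ioi fun t ht ↦ by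
      simp only [abs_of_pos (sub_pos.2 (Set.mem_Ioi.1 ht))]
      ring
  rw [h₁, h₂,
    integral_sub (integrable_stdNormalPDF.const_mul z).integrableOn
      integrable_mul_stdNormalPDF.integrableOn,
    integral_sub integrable_mul_stdNormalPDF.integrableOn
      (integrable_stdNormalPDF.const_mul z).integrableOn,
    integral_const_mul, integral_const_mul, setIntegral_Iic_mul_stdNormalPDF,
    setIntegral_Ioi_mul_stdNormalPDF, setIntegral_Ioi_stdNormalPDF, ← stdNormalCDF,
    stdNormalMeanAbsDev]
  ring

lemma integral_abs_sub_gaussianReal (μ y : ℝ) {σ : ℝ} {v : ℝ≥0} (hσ : 0 < σ)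
    (hv : (v : ℝ) = σ ^ 2) :
    ∫ x, |x - y| ∂(gaussianReal μ v) = σ * stdNormalMeanAbsDev ((y - μ) / σ) := by
  have hmap : gaussianReal μ v = (gaussianReal 0 1).map fun t ↦ μ + σ * t := by
    have h := Measure.map_map (μ := gaussianReal 0 1) (measurable_const_add μ)
      (measurable_const_mul σ)
    rw [gaussianReal_map_const_mul, gaussianReal_map_const_add] at h
    have hv' : v = .mk (σ ^ 2) (sq_nonneg σ) := NNReal.eq hv
    simpa [Function.comp_def, hv'] using h
  rw [hmap, integral_map (by fun_prop) (by fun_prop),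
    integral_gaussianReal_eq_integral_smul one_ne_zero, ← stdNormalPDF_eq_gaussianPDFReal,
    ← integral_stdNormalPDF_mul_abs_sub, ← integral_const_mul]
  refine integral_congr_ae (.of_forall fun t ↦ ?_)
  have h : μ + σ * t - y = σ * (t - (y - μ) / σ) := by field_simp; ring
  simp only [smul_eq_mul, h, abs_mul, abs_of_pos hσ]
  ring

lemma gaussianReal_prod_map_sub (μ₁ μ₂ : ℝ) (v₁ v₂ : ℝ≥0) :
    ((gaussianReal μ₁ v₁).prod (gaussianReal μ₂ v₂)).map (fun p ↦ p.1 - p.2)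
      = gaussianReal (μ₁ - μ₂) (v₁ + v₂) := by
  rw [sub_eq_add_neg, ← gaussianReal_conv_gaussianReal, ← gaussianReal_map_neg, Measure.conv,
    ← Measure.map_id (μ := gaussianReal μ₁ v₁),
    Measure.map_prod_map _ _ measurable_id measurable_neg, Measure.map_map (by fun_prop)
      (by fun_prop), Measure.map_id]
  simp [Function.comp_def, sub_eq_add_neg]

lemma stdNormalMeanAbsDev_zero : stdNormalMeanAbsDev 0 = 2 / √(2 * π) := by
  simp [stdNormalMeanAbsDev, stdNormalPDF, div_eq_mul_inv]

lemma integral_abs_sub_gaussianReal_prod_self (μ : ℝ) {σ : ℝ} {v : ℝ≥0} (hσ : 0 < σ)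
    (hv : (v : ℝ) = σ ^ 2) :
    ∫ p : ℝ × ℝ, |p.1 - p.2| ∂((gaussianReal μ v).prod (gaussianReal μ v)) = 2 * σ / √π := by
  have hvar : ((v + v : ℝ≥0) : ℝ) = (√2 * σ) ^ 2 := by
    rw [mul_pow, sq_sqrt zero_le_two, NNReal.coe_add, hv]
    ring
  have h := integral_abs_sub_gaussianReal (μ - μ) 0 (by positivity) hvar
  rw [← gaussianReal_prod_map_sub, integral_map (by fun_prop) (by fun_prop)] at h
  simp only [sub_self, sub_zero, zero_div, stdNormalMeanAbsDev_zero] at h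
  rw [h, sqrt_mul zero_le_two]
  field_simp

/-- Closed form of the SCRPS of `N(μ, σ²)` at `y`: with `z = (y − μ)/σ` and `X, X′`
independent `N(μ, σ²)`,
`E|X − y|/E|X − X′| + ½log(E|X − X′|) = (√π/2)(z(2Φ(z) − 1) + 2φ(z)) + ½log(2σ/√π)`. -/
theorem scrps_gaussian_closed_form (μ σ y : ℝ) (hσ : 0 < σ) (z : ℝ)
    (hz : z = (y - μ) / σ) :
    (∫ x, |x - y| ∂(gaussianReal μ ⟨σ ^ 2, sq_nonneg σ⟩)) /
        (∫ p : ℝ × ℝ, |p.1 - p.2|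
          ∂((gaussianReal μ ⟨σ ^ 2, sq_nonneg σ⟩).prod
              (gaussianReal μ ⟨σ ^ 2, sq_nonneg σ⟩))) +
      (1 / 2) * Real.log (∫ p : ℝ × ℝ, |p.1 - p.2|
          ∂((gaussianReal μ ⟨σ ^ 2, sq_nonneg σ⟩).prod
              (gaussianReal μ ⟨σ ^ 2, sq_nonneg σ⟩))) =
      (Real.sqrt π / 2) * (z * (2 * stdNormalCDF z - 1) + 2 * stdNormalPDF z) +
        (1 / 2) * Real.log (2 * σ / Real.sqrt π) := by
  rw [integral_abs_sub_gaussianReal_prod_self (v := ⟨σ ^ 2, sq_nonneg σ⟩) μ hσ rfl,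
    integral_abs_sub_gaussianReal (v := ⟨σ ^ 2, sq_nonneg σ⟩) μ y hσ rfl, ← hz,
    stdNormalMeanAbsDev]
  field_simp
end
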